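/- There exists a continuous surjection from [0,1] onto [0,1]² with finite square-to-linear ratio, i.e. the infimum κ over all such surjections of the supremum of |f(t)-f(t')|²/|t-t'| is attained and finite. -/

import Mathlib

open Set

/-- The unit square `[0,1]²` in the Euclidean plane. -/
def unitSquare : Set (EuclideanSpace ℝ (Fin 2)) :=
  {p | p 0 ∈ Icc (0:ℝ) 1 ∧ p 1 ∈ Icc (0:ℝ) 1}

/-- A unit Peano curve: a continuous surjection of `[0,1]` onto the unit square. -/
def IsUnitPeano (f : ℝ → EuclideanSpace ℝ (Fin 2)) : Prop :=
  ContinuousOn f (Icc 0 1) ∧ f '' Icc 0 1 = unitSquare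

/-- `C` bounds the square-to-linear ratio of `f` on `[0,1]`. -/
def RatioBound (f : ℝ → EuclideanSpace ℝ (Fin 2)) (C : ℝ) : Prop :=
  ∀ t ∈ Icc (0:ℝ) 1, ∀ t' ∈ Icc (0:ℝ) 1, ‖f t - f t'‖ ^ 2 ≤ C * |t - t'|

/-- Square-root Hölder maps have ultralimits, which keep the ratio bound and the image. -/
lemma peano_limit (f : ℕ → ℝ → EuclideanSpace ℝ (Fin 2)) (C : ℕ → ℝ) (c : ℝ)
    (hC : Filter.Tendsto C Filter.atTop (nhds c))
    (K : Set (EuclideanSpace ℝ (Fin 2))) (hK : IsCompact K)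
    (hfK : ∀ n, ∀ t ∈ Icc (0:ℝ) 1, f n t ∈ K)
    (hr : ∀ n, RatioBound (f n) (C n)) :
    ∃ g : ℝ → EuclideanSpace ℝ (Fin 2), RatioBound g c ∧ (∀ t ∈ Icc (0:ℝ) 1, g t ∈ K) ∧
      ∀ p (t : ℕ → ℝ), (∀ n, t n ∈ Icc (0:ℝ) 1) →
        Filter.Tendsto (fun n => f n (t n)) Filter.atTop (nhds p) → p ∈ g '' Icc 0 1 := by
  set U : Ultrafilter ℕ := Filter.hyperfilter ℕ with hU
  have hle : (U : Filter ℕ) ≤ Filter.atTop := by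
    rw [← Nat.cofinite_eq_atTop]; exact Filter.hyperfilter_le_cofinite
  have key : ∀ t : ℝ, ∃ y, t ∈ Icc (0:ℝ) 1 →
      (y ∈ K ∧ Filter.Tendsto (fun n => f n t) U (nhds y)) := by
    intro t
    by_cases ht : t ∈ Icc (0:ℝ) 1
    · obtain ⟨y, hy, hy'⟩ := hK.ultrafilter_le_nhds (U.map (fun n => f n t))
        (by simp only [Filter.le_principal_iff, Ultrafilter.mem_coe, Ultrafilter.mem_map]
            exact Filter.univ_mem' fun n => hfK n t ht)
      exact ⟨y, fun _ => ⟨hy, hy'⟩⟩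
    · exact ⟨0, fun h => absurd h ht⟩
  choose g hg using key
  have hC' := hC.mono_left hle
  have hgr : RatioBound g c := by
    intro s hs t ht
    refine le_of_tendsto_of_tendsto ((((hg s hs).2.sub (hg t ht).2).norm).pow 2)
      (hC'.mul_const (|s - t|)) (Filter.Eventually.of_forall fun n => hr n s hs t ht)
  refine ⟨g, hgr, fun t ht => (hg t ht).1, ?_⟩
  intro p t ht hp
  obtain ⟨s, hs, hs'⟩ := isCompact_Icc.ultrafilter_le_nhds (U.map t)
        (by simp only [Filter.le_principal_iff, Ultrafilter.mem_coe, Ultrafilter.mem_map]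
            exact Filter.univ_mem' fun n => ht n)
  have hs'' : Filter.Tendsto t U (nhds s) := hs'
  refine ⟨s, hs, ?_⟩
  have h1 := (((hg s hs).2.sub (hp.mono_left hle)).norm).pow 2
  have h2 : Filter.Tendsto (fun n => C n * |s - t n|) U (nhds (c * |s - s|)) :=
    hC'.mul ((tendsto_const_nhds.sub hs'').abs)
  have h3 := le_of_tendsto_of_tendsto h1 h2
    (Filter.Eventually.of_forall fun n => hr n s hs (t n) (ht n))
  simp only [sub_self, abs_zero, mul_zero] at h3
  have h4 : ‖g s - p‖ = 0 := by
    have := norm_nonneg (g s - p)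
    nlinarith
  exact sub_eq_zero.mp (norm_eq_zero.mp h4)

lemma unitSquare_compact : IsCompact unitSquare := by
  have h : unitSquare = (WithLp.toLp 2 : (Fin 2 → ℝ) → EuclideanSpace ℝ (Fin 2)) ''
      (Set.pi univ fun _ => Icc (0:ℝ) 1) := by
    ext p
    simp only [unitSquare, mem_setOf_eq, mem_image, Set.mem_pi, mem_univ, true_implies]
    constructor
    · rintro ⟨h0, h1⟩
      refine ⟨p.ofLp, ?_, rfl⟩
      intro i
      fin_cases i
      · exact h0
      · exact h1
    · rintro ⟨x, hx, rfl⟩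
      exact ⟨hx 0, hx 1⟩
  rw [h]
  exact (isCompact_univ_pi fun _ => isCompact_Icc).image (PiLp.continuous_toLp 2 _)

lemma ratio_continuousOn (f : ℝ → EuclideanSpace ℝ (Fin 2)) (C : ℝ) (h : RatioBound f C) :
    ContinuousOn f (Icc 0 1) := by
  intro s hs
  rw [ContinuousWithinAt, tendsto_iff_norm_sub_tendsto_zero]
  have h2 : Filter.Tendsto (fun t => Real.sqrt (C * |t - s|)) (nhdsWithin s (Icc 0 1))
      (nhds 0) := by
    have : Continuous (fun t => Real.sqrt (C * |t - s|)) := by fun_prop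
    have h3 := this.tendsto s
    simp only [sub_self, abs_zero, mul_zero, Real.sqrt_zero] at h3
    exact h3.mono_left nhdsWithin_le_nhds
  refine squeeze_zero' (Filter.Eventually.of_forall fun t => norm_nonneg _) ?_ h2
  filter_upwards [self_mem_nhdsWithin] with t ht
  exact Real.le_sqrt_of_sq_le (h t ht s hs)

/-- Approximations to the Pólya triangle-filling curve. -/
noncomputable def polya : ℕ → ℝ → ℝ × ℝ
  | 0, t => (t, 0)
  | n + 1, t =>
    if t ≤ 1 / 2 then
      (((polya n (2 * t)).1 + (polya n (2 * t)).2) / 2,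
        ((polya n (2 * t)).1 - (polya n (2 * t)).2) / 2)
    else
      ((1 + (polya n (2 * t - 1)).1 - (polya n (2 * t - 1)).2) / 2,
        (1 - (polya n (2 * t - 1)).1 - (polya n (2 * t - 1)).2) / 2)

lemma polya_mem (n : ℕ) : ∀ t ∈ Icc (0:ℝ) 1, 0 ≤ (polya n t).2 ∧
    (polya n t).2 ≤ (polya n t).1 ∧ (polya n t).2 ≤ 1 - (polya n t).1 := by
  induction n with
  | zero => intro t ht; simp only [polya]; exact ⟨le_refl _, ht.1, by linarith [ht.2]⟩
  | succ n ih =>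
    intro t ht
    obtain ⟨h0, h1⟩ := ht
    by_cases h : t ≤ 1 / 2
    · obtain ⟨a, b, c⟩ := ih (2 * t) ⟨by linarith, by linarith⟩
      simp only [polya, if_pos h]
      refine ⟨by linarith, by linarith, by linarith⟩
    · obtain ⟨a, b, c⟩ := ih (2 * t - 1) ⟨by linarith, by linarith⟩
      simp only [polya, if_neg h]
      refine ⟨by linarith, by linarith, by linarith⟩

lemma polya_ends (n : ℕ) : ∀ t ∈ Icc (0:ℝ) 1,
    (polya n t).1 ^ 2 + (polya n t).2 ^ 2 ≤ 2 * t ∧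
    (1 - (polya n t).1) ^ 2 + (polya n t).2 ^ 2 ≤ 2 * (1 - t) := by
  induction n with
  | zero => intro t ht; obtain ⟨h0, h1⟩ := ht; simp only [polya]; constructor <;> nlinarith
  | succ n ih =>
    intro t ht
    obtain ⟨a, b, c⟩ := polya_mem (n + 1) t ht
    obtain ⟨h0, h1⟩ := ht
    by_cases h : t ≤ 1 / 2
    · constructor
      · obtain ⟨i, j⟩ := ih (2 * t) ⟨by linarith, by linarith⟩
        simp only [polya, if_pos h]
        nlinarith
      · nlinarith
    · constructor
      · nlinarith
      · obtain ⟨i, j⟩ := ih (2 * t - 1) ⟨by linarith, by linarith⟩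
        simp only [polya, if_neg h]
        nlinarith

lemma polya_ratio (n : ℕ) : ∀ s ∈ Icc (0:ℝ) 1, ∀ t ∈ Icc (0:ℝ) 1, s ≤ t →
    ((polya n s).1 - (polya n t).1) ^ 2 + ((polya n s).2 - (polya n t).2) ^ 2
      ≤ 4 * (t - s) := by
  induction n with
  | zero =>
    intro s hs t ht hst
    obtain ⟨h0, h1⟩ := hs
    obtain ⟨h2, h3⟩ := ht
    simp only [polya]; nlinarith
  | succ n ih =>
    intro s hs t ht hst
    obtain ⟨h0, h1⟩ := hs
    obtain ⟨h2, h3⟩ := ht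
    by_cases h : t ≤ 1 / 2
    · have h' : s ≤ 1 / 2 := by linarith
      have := ih (2 * s) ⟨by linarith, by linarith⟩ (2 * t) ⟨by linarith, by linarith⟩
        (by linarith)
      simp only [polya, if_pos h, if_pos h']
      nlinarith
    · by_cases h' : s ≤ 1 / 2
      · have e1 := (polya_ends n (2 * s) ⟨by linarith, by linarith⟩).2
        have e2 := (polya_ends n (2 * t - 1) ⟨by linarith, by linarith⟩).1
        simp only [polya, if_neg h, if_pos h']
        generalize (polya n (2 * s)).1 = a at *
        generalize (polya n (2 * s)).2 = b at *
        generalize (polya n (2 * t - 1)).1 = c at *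
        generalize (polya n (2 * t - 1)).2 = d at *
        nlinarith [sq_nonneg ((a + b - 1) + (c - d)), sq_nonneg ((a - b - 1) - (c + d))]
      · have := ih (2 * s - 1) ⟨by linarith, by linarith⟩ (2 * t - 1)
          ⟨by linarith, by linarith⟩ (by linarith)
        simp only [polya, if_neg h, if_neg h']
        nlinarith

lemma polya_dense (n : ℕ) : ∀ x y : ℝ, 0 ≤ y → y ≤ x → y ≤ 1 - x → ∃ t ∈ Icc (0:ℝ) 1,
    ((polya n t).1 - x) ^ 2 + ((polya n t).2 - y) ^ 2 ≤ (1 / 2) ^ n := by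
  induction n with
  | zero =>
    intro x y h0 h1 h2
    refine ⟨0, ⟨le_refl _, zero_le_one⟩, ?_⟩
    simp only [polya]; nlinarith
  | succ n ih =>
    intro x y h0 h1 h2
    by_cases h : x ≤ 1 / 2
    · obtain ⟨t, ⟨ht0, ht1⟩, ht⟩ := ih (x + y) (x - y) (by linarith) (by linarith) (by linarith)
      refine ⟨t / 2, ⟨by linarith, by linarith⟩, ?_⟩
      have e : 2 * (t / 2) = t := by ring
      simp only [polya, if_pos (show t / 2 ≤ 1 / 2 by linarith), e, pow_succ]
      nlinarith
    · obtain ⟨t, ⟨ht0, ht1⟩, ht⟩ := ih (x - y) (1 - x - y) (by linarith) (by linarith)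
        (by linarith)
      by_cases h5 : t = 0
      · have e := polya_ends n t ⟨ht0, ht1⟩
        have e' := polya_ends n 1 ⟨zero_le_one, le_refl _⟩
        have a1 : (polya n t).1 = 0 := by nlinarith [sq_nonneg (polya n t).1, sq_nonneg (polya n t).2]
        have a2 : (polya n t).2 = 0 := by nlinarith [sq_nonneg (polya n t).1, sq_nonneg (polya n t).2]
        have a3 : (polya n 1).1 = 1 := by
          nlinarith [sq_nonneg (1 - (polya n 1).1), sq_nonneg (polya n 1).2]
        have a4 : (polya n 1).2 = 0 := by
          nlinarith [sq_nonneg (1 - (polya n 1).1), sq_nonneg (polya n 1).2]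
        refine ⟨1 / 2, ⟨by norm_num, by norm_num⟩, ?_⟩
        have e : 2 * (1 / 2 : ℝ) = 1 := by norm_num
        rw [a1, a2] at ht
        simp only [polya, if_pos (le_refl (1 / 2 : ℝ)), e, a3, a4, pow_succ]
        nlinarith
      · have h6 : 0 < t := lt_of_le_of_ne ht0 (Ne.symm h5)
        refine ⟨(t + 1) / 2, ⟨by linarith, by linarith⟩, ?_⟩
        have e : 2 * ((t + 1) / 2) - 1 = t := by ring
        simp only [polya, if_neg (show ¬ (t + 1) / 2 ≤ 1 / 2 by linarith), e, pow_succ]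
        nlinarith

/-- Clamping to `[0,1]`. -/
noncomputable def clampUnit (x : ℝ) : ℝ := max 0 (min 1 x)

lemma clampUnit_mem (x : ℝ) : clampUnit x ∈ Icc (0:ℝ) 1 :=
  ⟨le_max_left _ _, max_le zero_le_one (min_le_left _ _)⟩

lemma clampUnit_of_mem {x : ℝ} (h : x ∈ Icc (0:ℝ) 1) : clampUnit x = x := by
  rw [clampUnit, min_eq_right h.2, max_eq_right h.1]

lemma clampUnit_sq (x y : ℝ) : (clampUnit x - clampUnit y) ^ 2 ≤ (x - y) ^ 2 := by
  rw [sq_le_sq]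
  unfold clampUnit
  refine (abs_max_sub_max_le_max _ _ _ _).trans ?_
  simp only [sub_self, abs_zero]
  refine max_le (abs_nonneg _) ((abs_min_sub_min_le_max _ _ _ _).trans ?_)
  simp

/-- Clamped approximations to a square-filling curve. -/
noncomputable def sqApprox (n : ℕ) (t : ℝ) : EuclideanSpace ℝ (Fin 2) :=
  !₂[clampUnit (3 * (polya n t).1 - 1), clampUnit (3 * (polya n t).2)]

lemma sqApprox_ratio (n : ℕ) : RatioBound (sqApprox n) 36 := by
  have main : ∀ s ∈ Icc (0:ℝ) 1, ∀ t ∈ Icc (0:ℝ) 1, s ≤ t →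
      ‖sqApprox n s - sqApprox n t‖ ^ 2 ≤ 36 * (t - s) := by
    intro s hs t ht hst
    have h := polya_ratio n s hs t ht hst
    rw [EuclideanSpace.norm_sq_eq]
    simp only [sqApprox, Fin.sum_univ_two, PiLp.sub_apply, Real.norm_eq_abs, sq_abs]
    simp only [PiLp.toLp_apply, Matrix.cons_val_zero, Matrix.cons_val_one]
    have h1 := clampUnit_sq (3 * (polya n s).1 - 1) (3 * (polya n t).1 - 1)
    have h2 := clampUnit_sq (3 * (polya n s).2) (3 * (polya n t).2)
    nlinarith
  intro s hs t ht
  rcases le_total s t with h | h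
  · rw [abs_sub_comm, abs_of_nonneg (sub_nonneg.mpr h)]
    exact main s hs t ht h
  · rw [norm_sub_rev, abs_of_nonneg (sub_nonneg.mpr h)]
    exact main t ht s hs h

lemma exists_peano : ∃ g, IsUnitPeano g ∧ RatioBound g 36 := by
  obtain ⟨g, hr, hK, hp⟩ := peano_limit sqApprox (fun _ => 36) 36 tendsto_const_nhds
    unitSquare unitSquare_compact
    (fun n t _ => ⟨by simpa [sqApprox] using clampUnit_mem _,
      by simpa [sqApprox] using clampUnit_mem _⟩) sqApprox_ratio
  refine ⟨g, ⟨ratio_continuousOn g 36 hr, ?_⟩, hr⟩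
  apply Subset.antisymm
  · rintro _ ⟨t, ht, rfl⟩; exact hK t ht
  · rintro p ⟨h0, h1⟩
    choose t ht htd using fun n => polya_dense n ((p 0 + 1) / 3) (p 1 / 3)
      (by linarith [h1.1]) (by linarith [h1.2, h0.1]) (by linarith [h1.2, h0.2])
    refine hp p t ht ?_
    rw [tendsto_iff_norm_sub_tendsto_zero]
    have hlim : Filter.Tendsto (fun n : ℕ => Real.sqrt (9 * (1 / 2 : ℝ) ^ n)) Filter.atTop
        (nhds 0) := by
      have := ((tendsto_pow_atTop_nhds_zero_of_lt_one (r := (1 / 2 : ℝ)) (by norm_num)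
        (by norm_num)).const_mul 9).sqrt
      simpa using this
    refine squeeze_zero (fun n => norm_nonneg _) (fun n => Real.le_sqrt_of_sq_le ?_) hlim
    have h := htd n
    rw [EuclideanSpace.norm_sq_eq]
    simp only [sqApprox, Fin.sum_univ_two, PiLp.sub_apply, Real.norm_eq_abs, sq_abs]
    simp only [PiLp.toLp_apply, Matrix.cons_val_zero, Matrix.cons_val_one]
    have h2 := clampUnit_sq (3 * (polya n (t n)).1 - 1) (p 0)
    have h3 := clampUnit_sq (3 * (polya n (t n)).2) (p 1)
    rw [clampUnit_of_mem h0] at h2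
    rw [clampUnit_of_mem h1] at h3
    nlinarith

/-- There is a unit Peano curve with finite square-to-linear ratio, and moreover the
infimum `κ` (the Peano constant) over all unit Peano curves of the least upper bound
of the square-to-linear ratio is attained by some curve. -/
theorem peano_constant_attained :
    ∃ (f : ℝ → EuclideanSpace ℝ (Fin 2)) (C : ℝ),
      IsUnitPeano f ∧ RatioBound f C ∧
      ∀ (g : ℝ → EuclideanSpace ℝ (Fin 2)) (C' : ℝ),
        IsUnitPeano g → RatioBound g C' → C ≤ C' := by
  set S : Set ℝ := {C | ∃ g, IsUnitPeano g ∧ RatioBound g C} with hS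
  have hne : S.Nonempty := ⟨36, exists_peano⟩
  have hbd : BddBelow S := by
    refine ⟨0, ?_⟩
    rintro C ⟨g, -, hg⟩
    have := hg 1 ⟨zero_le_one, le_refl _⟩ 0 ⟨le_refl _, zero_le_one⟩
    simp only [sub_zero, abs_one, mul_one] at this
    exact (sq_nonneg _).trans this
  obtain ⟨u, -, hu, huS⟩ := exists_seq_tendsto_sInf hne hbd
  choose f hf hfr using huS
  obtain ⟨g, hr, hK, hp⟩ := peano_limit f u _ hu unitSquare unitSquare_compact
    (fun n t ht => by rw [← (hf n).2]; exact ⟨t, ht, rfl⟩) hfr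
  refine ⟨g, sInf S, ⟨ratio_continuousOn g _ hr, ?_⟩, hr, fun g' C' h1 h2 =>
    csInf_le hbd ⟨g', h1, h2⟩⟩
  apply Subset.antisymm
  · rintro _ ⟨t, ht, rfl⟩; exact hK t ht
  · intro p hpS
    have : ∀ n, ∃ t ∈ Icc (0:ℝ) 1, f n t = p := fun n => by
      rw [← (hf n).2] at hpS; exact hpS
    choose t ht htp using this
    refine hp p t ht ?_
    simp only [htp]
    exact tendsto_const_nhds
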